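/- For every σ ∈ [0,1], the infinite matrix A(σ) indexed by m,n ∈ ℕ = {1,2,3,…} with entries A(σ)_{mn} = 0 for m = n, A(σ)_{mn} = −(i/n)·f_σ(m/n) for m < n, and A(σ)_{mn} = (i/m)·f_σ(n/m) for m > n defines a bounded linear operator on ℓ²(ℕ), and its operator norm satisfies ‖A(σ)‖ ≤ (√2/3 + 4)·π²·σ. -/

import Mathlib

/-- **Schur test**: a matrix whose absolute values satisfy weighted row and column bounds with
constant `C` is the matrix of an operator on `ℓ²` of norm at most `C`. -/
theorem exists_clm_of_schur_test {ι : Type*} [DecidableEq ι] (A : ι → ι → ℂ) (w : ι → ℝ)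
    (hw : ∀ i, 0 < w i) {C : ℝ} (hC : 0 ≤ C)
    (hrow : ∀ m, ∀ S : Finset ι, ∑ n ∈ S, ‖A m n‖ * w n ≤ C * w m)
    (hcol : ∀ n, ∀ S : Finset ι, ∑ m ∈ S, ‖A m n‖ * w m ≤ C * w n) :
    ∃ T : lp (fun _ : ι => ℂ) 2 →L[ℂ] lp (fun _ : ι => ℂ) 2,
      ‖T‖ ≤ C ∧ ∀ m n : ι,
        @inner ℂ _ _ (lp.single 2 m (1 : ℂ)) (T (lp.single 2 n (1 : ℂ))) = A m n := by
  have two_toReal : (2 : ENNReal).toReal = 2 := by norm_num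
  have two_pos : 0 < (2 : ENNReal).toReal := by norm_num
  have norm_sq : ∀ x : lp (fun _ : ι => ℂ) 2, HasSum (fun n => ‖x n‖ ^ 2) (‖x‖ ^ 2) := by
    intro x
    have h := lp.hasSum_norm two_pos x
    simpa [two_toReal] using h
  have summable_row : ∀ m, Summable fun n => ‖A m n‖ * w n := fun m =>
    summable_of_sum_le (fun n => mul_nonneg (norm_nonneg _) (hw n).le) (hrow m)
  have row_le : ∀ m, ∑' n, ‖A m n‖ * w n ≤ C * w m := fun m =>
    (summable_row m).tsum_le_of_sum_le (hrow m)
  have summable_sq : ∀ (x : lp (fun _ : ι => ℂ) 2) m,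
      Summable fun n => ‖A m n‖ * (‖x n‖ ^ 2 / w n) := by
    intro x m
    refine Summable.of_nonneg_of_le
      (fun n => mul_nonneg (norm_nonneg _) (div_nonneg (sq_nonneg _) (hw n).le)) (fun n => ?_)
      ((norm_sq x).summable.mul_left (C / w m))
    have h := hcol n {m}
    rw [Finset.sum_singleton] at h
    have h' : ‖A m n‖ / w n ≤ C / w m := by
      rw [div_le_div_iff₀ (hw n) (hw m)]; exact h
    calc ‖A m n‖ * (‖x n‖ ^ 2 / w n) = ‖A m n‖ / w n * ‖x n‖ ^ 2 := by ring
      _ ≤ _ := mul_le_mul_of_nonneg_right h' (sq_nonneg _)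
  have summable_apply : ∀ (x : lp (fun _ : ι => ℂ) 2) m, Summable fun n => ‖A m n * x n‖ := by
    intro x m
    refine Summable.of_nonneg_of_le (fun n => norm_nonneg _) (fun n => ?_)
      ((summable_row m).add (summable_sq x m))
    rw [norm_mul, ← mul_add]
    refine mul_le_mul_of_nonneg_left ?_ (norm_nonneg _)
    have hn := hw n
    rw [← sub_nonneg]
    have : w n + ‖x n‖ ^ 2 / w n - ‖x n‖ =
        ((w n - ‖x n‖ / 2) ^ 2 + 3 / 4 * ‖x n‖ ^ 2) / w n := by
      field_simp; ring
    rw [this]; positivity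
  have cauchy_schwarz : ∀ (x : lp (fun _ : ι => ℂ) 2) m,
      ‖∑' n, A m n * x n‖ ^ 2 ≤ C * w m * ∑' n, ‖A m n‖ * (‖x n‖ ^ 2 / w n) := by
    intro x m
    have hfin : ∀ S : Finset ι, ‖∑ n ∈ S, A m n * x n‖ ^ 2 ≤
        C * w m * ∑' n, ‖A m n‖ * (‖x n‖ ^ 2 / w n) := by
      intro S
      calc ‖∑ n ∈ S, A m n * x n‖ ^ 2 ≤ (∑ n ∈ S, ‖A m n * x n‖) ^ 2 := by
            gcongr; exact norm_sum_le _ _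
        _ ≤ (∑ n ∈ S, ‖A m n‖ * w n) * ∑ n ∈ S, ‖A m n‖ * (‖x n‖ ^ 2 / w n) := by
            refine Finset.sum_sq_le_sum_mul_sum_of_sq_le_mul S
              (fun n _ => mul_nonneg (norm_nonneg _) (hw n).le)
              (fun n _ => mul_nonneg (norm_nonneg _) (div_nonneg (sq_nonneg _) (hw n).le))
              (fun n _ => ?_)
            have := (hw n).ne'
            refine le_of_eq ?_
            rw [norm_mul]; field_simp
        _ ≤ _ := by
            refine mul_le_mul (hrow m S) ((summable_sq x m).sum_le_tsum S fun n _ => ?_)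
              (Finset.sum_nonneg fun n _ => ?_) (mul_nonneg hC (hw m).le)
            all_goals exact mul_nonneg (norm_nonneg _) (div_nonneg (sq_nonneg _) (hw n).le)
    exact le_of_tendsto (((summable_apply x m).of_norm.hasSum.norm).pow 2)
      (Filter.Eventually.of_forall hfin)
  have sum_le : ∀ (x : lp (fun _ : ι => ℂ) 2) (S : Finset ι),
      ∑ m ∈ S, ‖∑' n, A m n * x n‖ ^ 2 ≤ (C * ‖x‖) ^ 2 := by
    intro x S
    calc ∑ m ∈ S, ‖∑' n, A m n * x n‖ ^ 2
        ≤ ∑ m ∈ S, ∑' n, C * w m * (‖A m n‖ * (‖x n‖ ^ 2 / w n)) := by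
          refine Finset.sum_le_sum fun m _ => ?_
          rw [tsum_mul_left]; exact cauchy_schwarz x m
      _ = ∑' n, ∑ m ∈ S, C * w m * (‖A m n‖ * (‖x n‖ ^ 2 / w n)) :=
          (Summable.tsum_finsetSum fun m _ => (summable_sq x m).mul_left _).symm
      _ ≤ ∑' n, C ^ 2 * ‖x n‖ ^ 2 := by
          refine Summable.tsum_le_tsum (fun n => ?_)
            (summable_sum fun m _ => (summable_sq x m).mul_left _)
            ((norm_sq x).summable.mul_left _)
          have hn := hw n
          calc ∑ m ∈ S, C * w m * (‖A m n‖ * (‖x n‖ ^ 2 / w n))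
              = C * (‖x n‖ ^ 2 / w n) * ∑ m ∈ S, ‖A m n‖ * w m := by
                rw [Finset.mul_sum]; exact Finset.sum_congr rfl fun m _ => by ring
            _ ≤ C * (‖x n‖ ^ 2 / w n) * (C * w n) :=
                mul_le_mul_of_nonneg_left (hcol n S) (by positivity)
            _ = C ^ 2 * ‖x n‖ ^ 2 := by field_simp
      _ = (C * ‖x‖) ^ 2 := by rw [tsum_mul_left, (norm_sq x).tsum_eq, mul_pow]
  have mem : ∀ x : lp (fun _ : ι => ℂ) 2, Memℓp (fun m => ∑' n, A m n * x n) 2 := by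
    intro x
    refine memℓp_gen' (C := (C * ‖x‖) ^ 2) fun S => ?_
    simpa [two_toReal] using sum_le x S
  let L : lp (fun _ : ι => ℂ) 2 →ₗ[ℂ] lp (fun _ : ι => ℂ) 2 :=
    { toFun := fun x => ⟨fun m => ∑' n, A m n * x n, mem x⟩
      map_add' := fun x y => by
        ext m
        change ∑' n, A m n * (x n + y n) = ∑' n, A m n * x n + ∑' n, A m n * y n
        rw [← (summable_apply x m).of_norm.tsum_add (summable_apply y m).of_norm]
        simp only [mul_add]
      map_smul' := fun c x => by
        ext m
        change ∑' n, A m n * (c * x n) = c * ∑' n, A m n * x n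
        rw [← tsum_mul_left]
        exact tsum_congr fun n => by ring }
  refine ⟨L.mkContinuous C fun x => ?_, L.mkContinuous_norm_le hC _, fun m n => ?_⟩
  · refine lp.norm_le_of_forall_sum_le two_pos (by positivity) fun S => ?_
    simpa [two_toReal, L] using sum_le x S
  · rw [lp.inner_single_left]
    change inner ℂ 1 (∑' k, A m k * (lp.single 2 n (1 : ℂ) : lp (fun _ : ι => ℂ) 2) k) = A m n
    rw [tsum_eq_single n fun k hk => by simp [hk]]
    simp

/-- The fourth root of a natural number. -/
noncomputable def fourthRoot (n : ℕ) : ℝ := √√(n : ℝ)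

theorem fourthRoot_nonneg (n : ℕ) : 0 ≤ fourthRoot n := Real.sqrt_nonneg _

theorem fourthRoot_pos {n : ℕ} (hn : 0 < n) : 0 < fourthRoot n := by
  unfold fourthRoot; positivity

theorem fourthRoot_pow_four (n : ℕ) : fourthRoot n ^ 4 = n := by
  unfold fourthRoot
  rw [show 4 = 2 * 2 from rfl, pow_mul, Real.sq_sqrt (Real.sqrt_nonneg _),
    Real.sq_sqrt (Nat.cast_nonneg n)]

theorem fourthRoot_lt {m n : ℕ} (h : m < n) : fourthRoot m < fourthRoot n :=
  Real.sqrt_lt_sqrt (Real.sqrt_nonneg _)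
    (Real.sqrt_lt_sqrt (Nat.cast_nonneg m) (Nat.cast_lt.mpr h))

theorem one_le_four_mul_fourthRoot_pow_mul_sub (n : ℕ) :
    1 ≤ 4 * fourthRoot (n + 1) ^ 3 * (fourthRoot (n + 1) - fourthRoot n) := by
  have hb := fourthRoot_nonneg n
  have hab := fourthRoot_lt n.lt_succ_self
  have ha4 := fourthRoot_pow_four (n + 1)
  have hb4 := fourthRoot_pow_four n
  push_cast at ha4
  simp only [Nat.succ_eq_add_one] at hab
  set a := fourthRoot (n + 1)
  set b := fourthRoot n
  have ha : 0 ≤ a := hb.trans hab.le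
  have h2 : b ^ 2 ≤ a ^ 2 := by gcongr
  have h : (a + b) * (a ^ 2 + b ^ 2) ≤ (a + a) * (a ^ 2 + a ^ 2) := by gcongr
  have := mul_le_mul_of_nonneg_right h (sub_nonneg.mpr hab.le)
  nlinarith

theorem inv_fourthRoot_pow_three_le (n : ℕ) :
    1 / fourthRoot (n + 1) ^ 3 ≤ 4 * fourthRoot (n + 1) - 4 * fourthRoot n := by
  have ha := fourthRoot_pos n.succ_pos
  rw [div_le_iff₀ (by positivity)]
  linarith [one_le_four_mul_fourthRoot_pow_mul_sub n]

theorem inv_fourthRoot_pow_five_le {n : ℕ} (hn : 0 < n) :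
    1 / fourthRoot (n + 1) ^ 5 ≤ -4 / fourthRoot (n + 1) - -4 / fourthRoot n := by
  have ha := fourthRoot_pos n.succ_pos
  have hb := fourthRoot_pos hn
  have hab := fourthRoot_lt n.lt_succ_self
  have h := one_le_four_mul_fourthRoot_pow_mul_sub n
  simp only [Nat.succ_eq_add_one] at hab ha
  set a := fourthRoot (n + 1)
  set b := fourthRoot n
  have : -4 / a - -4 / b = 4 * (a - b) / (a * b) := by field_simp; ring
  rw [this, div_le_div_iff₀ (by positivity) (by positivity)]
  calc 1 * (a * b) ≤ (4 * a ^ 3 * (a - b)) * (a * a) := by gcongr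
    _ = 4 * (a - b) * a ^ 5 := by ring

theorem sum_le_sub_of_le_sub {g f : ℕ → ℝ} {a b : ℕ} (hab : a ≤ b) (hg : ∀ n, 0 ≤ g n)
    (h : ∀ n, a ≤ n → g (n + 1) ≤ f (n + 1) - f n) (S : Finset ℕ+)
    (hS : ∀ n ∈ S, a < (n : ℕ) ∧ (n : ℕ) ≤ b) :
    ∑ n ∈ S, g n ≤ f b - f a := by
  have hIoc : ∑ n ∈ Finset.Ioc a b, g n ≤ f b - f a := by
    clear hS
    induction b, hab using Nat.le_induction with
    | base => simp
    | succ b hb ih =>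
      rw [Finset.sum_Ioc_succ_top hb]
      linarith [h b hb]
  calc ∑ n ∈ S, g n = ∑ k ∈ S.map ⟨PNat.val, PNat.coe_injective⟩, g k := by
        rw [Finset.sum_map]; rfl
    _ ≤ ∑ n ∈ Finset.Ioc a b, g n := by
        refine Finset.sum_le_sum_of_subset_of_nonneg (fun k hk => ?_) fun _ _ _ => hg _
        obtain ⟨n, hn, rfl⟩ := Finset.mem_map.mp hk
        exact Finset.mem_Ioc.mpr (hS n hn)
    _ ≤ _ := hIoc

theorem difference_quotient_div_le {σ : ℝ} (hσ : 0 ≤ σ) {a b : ℕ} (ha : 0 < a) (hab : a < b) :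
    |1 / (b : ℝ) * ((1 - ((a : ℝ) / b) ^ σ) / (1 - (a : ℝ) / b))| ≤
      4 * σ / (fourthRoot a * fourthRoot b ^ 3) := by
  have hp := fourthRoot_pos ha
  have hpq := fourthRoot_lt hab
  rw [← fourthRoot_pow_four a, ← fourthRoot_pow_four b]
  set p := fourthRoot a
  set q := fourthRoot b
  have hq : 0 < q := hp.trans hpq
  have hpq4 : p ^ 4 < q ^ 4 := by gcongr
  have hu : 0 < p ^ 4 / q ^ 4 := by positivity
  have hlow : 1 - (p ^ 4 / q ^ 4) ^ σ ≤ 4 * σ * ((q - p) / p) := by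
    have h1 : Real.log (p ^ 4 / q ^ 4) = -(4 * Real.log (q / p)) := by
      rw [← div_pow, Real.log_pow, ← inv_div, Real.log_inv]; push_cast; ring
    have h2 : Real.log (q / p) ≤ (q - p) / p := by
      have := Real.log_le_sub_one_of_pos (div_pos hq hp)
      rwa [sub_div, div_self hp.ne']
    have h3 := Real.add_one_le_exp (Real.log (p ^ 4 / q ^ 4) * σ)
    rw [← Real.rpow_def_of_pos hu, h1] at h3
    nlinarith [mul_le_mul_of_nonneg_left h2 hσ]
  have hnonneg : 0 ≤ 1 - (p ^ 4 / q ^ 4) ^ σ :=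
    sub_nonneg.mpr (Real.rpow_le_one hu.le ((div_le_one (by positivity)).mpr hpq4.le) hσ)
  have hd : 0 < q ^ 4 - p ^ 4 := sub_pos.mpr hpq4
  have heq : 1 / q ^ 4 * ((1 - (p ^ 4 / q ^ 4) ^ σ) / (1 - p ^ 4 / q ^ 4)) =
      (1 - (p ^ 4 / q ^ 4) ^ σ) / (q ^ 4 - p ^ 4) := by
    rw [one_sub_div (pow_pos hq 4).ne']
    generalize 1 - (p ^ 4 / q ^ 4) ^ σ = t
    field_simp
  rw [heq, abs_of_nonneg (div_nonneg hnonneg hd.le)]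
  have hqp : 0 < q - p := sub_pos.mpr hpq
  calc (1 - (p ^ 4 / q ^ 4) ^ σ) / (q ^ 4 - p ^ 4)
      ≤ 4 * σ * ((q - p) / p) / (q ^ 4 - p ^ 4) := by gcongr
    _ ≤ 4 * σ * ((q - p) / p) / ((q - p) * q ^ 3) := by
        gcongr
        have : 0 ≤ (q - p) * (p * q ^ 2 + p ^ 2 * q + p ^ 3) := by positivity
        linarith
    _ = 4 * σ / (p * q ^ 3) := by field_simp

theorem sum_norm_mul_inv_fourthRoot_sq_le {σ : ℝ} (hσ : 0 ≤ σ) (B : ℕ+ → ℂ) (m : ℕ+)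
    (hdiag : B m = 0)
    (hlt : ∀ n, n < m → ‖B n‖ ≤ 4 * σ / (fourthRoot n * fourthRoot m ^ 3))
    (hgt : ∀ n, m < n → ‖B n‖ ≤ 4 * σ / (fourthRoot m * fourthRoot n ^ 3)) (S : Finset ℕ+) :
    ∑ n ∈ S, ‖B n‖ * (1 / fourthRoot n ^ 2) ≤ 32 * σ * (1 / fourthRoot m ^ 2) := by
  have hpos : ∀ n : ℕ+, 0 < fourthRoot n := fun n => fourthRoot_pos n.pos
  have hm := hpos m
  have hinv : ∀ k n : ℕ, 0 ≤ 1 / fourthRoot n ^ k := fun k n =>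
    one_div_nonneg.mpr (pow_nonneg (fourthRoot_nonneg n) k)
  have hlower : ∑ n ∈ S with n < m, ‖B n‖ * (1 / fourthRoot n ^ 2) ≤
      16 * σ * (1 / fourthRoot m ^ 2) := by
    have hsum : ∑ n ∈ S with n < m, 1 / fourthRoot n ^ 3 ≤
        4 * fourthRoot m - 4 * fourthRoot 0 :=
      sum_le_sub_of_le_sub (g := fun n => 1 / fourthRoot n ^ 3) (f := fun n => 4 * fourthRoot n)
        (Nat.zero_le _) (hinv 3) (fun n _ => inv_fourthRoot_pow_three_le n) _
        fun n hn => ⟨n.pos, (PNat.coe_lt_coe _ _).mpr (Finset.mem_filter.mp hn).2 |>.le⟩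
    have h0 := fourthRoot_nonneg 0
    calc ∑ n ∈ S with n < m, ‖B n‖ * (1 / fourthRoot n ^ 2)
        ≤ ∑ n ∈ S with n < m, 4 * σ / fourthRoot m ^ 3 * (1 / fourthRoot n ^ 3) := by
          refine Finset.sum_le_sum fun n hn => ?_
          have hn' := hpos n
          calc ‖B n‖ * (1 / fourthRoot n ^ 2)
              ≤ 4 * σ / (fourthRoot n * fourthRoot m ^ 3) * (1 / fourthRoot n ^ 2) :=
                mul_le_mul_of_nonneg_right (hlt n (Finset.mem_filter.mp hn).2) (hinv 2 n)
            _ = _ := by field_simp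
      _ ≤ 4 * σ / fourthRoot m ^ 3 * (4 * fourthRoot m) := by
          rw [← Finset.mul_sum]
          exact mul_le_mul_of_nonneg_left (by linarith) (by positivity)
      _ = 16 * σ * (1 / fourthRoot m ^ 2) := by field_simp; ring
  have hupper : ∑ n ∈ S with m < n, ‖B n‖ * (1 / fourthRoot n ^ 2) ≤
      16 * σ * (1 / fourthRoot m ^ 2) := by
    obtain ⟨b, hb⟩ : ∃ b : ℕ, ∀ n ∈ insert m S, (n : ℕ) ≤ b :=
      ⟨(insert m S).sup PNat.val, fun n hn => Finset.le_sup (f := PNat.val) hn⟩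
    have hsum : ∑ n ∈ S with m < n, 1 / fourthRoot n ^ 5 ≤
        -4 / fourthRoot b - -4 / fourthRoot m :=
      sum_le_sub_of_le_sub (g := fun n => 1 / fourthRoot n ^ 5) (f := fun n => -4 / fourthRoot n)
        (hb m (Finset.mem_insert_self _ _)) (hinv 5)
        (fun n hn => inv_fourthRoot_pow_five_le (m.pos.trans_le hn)) _
        fun n hn => ⟨(PNat.coe_lt_coe _ _).mpr (Finset.mem_filter.mp hn).2,
          hb n (Finset.mem_insert_of_mem (Finset.mem_filter.mp hn).1)⟩
    have hb0 : -4 / fourthRoot b ≤ 0 :=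
      div_nonpos_of_nonpos_of_nonneg (by norm_num) (fourthRoot_nonneg b)
    rw [neg_div (fourthRoot m) 4] at hsum
    calc ∑ n ∈ S with m < n, ‖B n‖ * (1 / fourthRoot n ^ 2)
        ≤ ∑ n ∈ S with m < n, 4 * σ / fourthRoot m * (1 / fourthRoot n ^ 5) := by
          refine Finset.sum_le_sum fun n hn => ?_
          have hn' := hpos n
          calc ‖B n‖ * (1 / fourthRoot n ^ 2)
              ≤ 4 * σ / (fourthRoot m * fourthRoot n ^ 3) * (1 / fourthRoot n ^ 2) :=
                mul_le_mul_of_nonneg_right (hgt n (Finset.mem_filter.mp hn).2) (hinv 2 n)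
            _ = _ := by field_simp
      _ ≤ 4 * σ / fourthRoot m * (4 / fourthRoot m) := by
          rw [← Finset.mul_sum]
          exact mul_le_mul_of_nonneg_left (by linarith) (by positivity)
      _ = 16 * σ * (1 / fourthRoot m ^ 2) := by field_simp; ring
  have hsplit : ∑ n ∈ S, ‖B n‖ * (1 / fourthRoot n ^ 2) =
      ∑ n ∈ S with n < m, ‖B n‖ * (1 / fourthRoot n ^ 2) +
        ∑ n ∈ S with m < n, ‖B n‖ * (1 / fourthRoot n ^ 2) := by
    rw [Finset.sum_filter, Finset.sum_filter, ← Finset.sum_add_distrib]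
    refine Finset.sum_congr rfl fun n _ => ?_
    rcases lt_trichotomy n m with h | rfl | h
    · simp [h, h.not_gt]
    · simp [hdiag]
    · simp [h, h.not_gt]
  linarith


/-- For every `σ ∈ [0,1]`, the infinite matrix indexed by positive integers
with entries `0` on the diagonal, `-(i/n)·f_σ(m/n)` for `m < n` and `(i/m)·f_σ(n/m)` for
`m > n`, where `f_σ(u) = (1 − u^σ)/(1 − u)`, defines a bounded linear operator on `ℓ²(ℕ)`
of operator norm at most `(√2/3 + 4)·π²·σ`. -/
theorem stmt_4 (σ : ℝ) (hσ : σ ∈ Set.Icc (0 : ℝ) 1) :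
    ∃ T : lp (fun _ : ℕ+ => ℂ) 2 →L[ℂ] lp (fun _ : ℕ+ => ℂ) 2,
      ‖T‖ ≤ (Real.sqrt 2 / 3 + 4) * Real.pi ^ 2 * σ ∧
      ∀ m n : ℕ+,
        @inner ℂ _ _ (lp.single 2 m (1 : ℂ)) (T (lp.single 2 n (1 : ℂ))) =
          if m = n then 0
          else if m < n then
            -(Complex.I / ((n : ℕ) : ℂ)) *
              (((1 - (((m : ℕ) : ℝ) / ((n : ℕ) : ℝ)) ^ σ) /
                  (1 - ((m : ℕ) : ℝ) / ((n : ℕ) : ℝ)) : ℝ) : ℂ)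
          else
            (Complex.I / ((m : ℕ) : ℂ)) *
              (((1 - (((n : ℕ) : ℝ) / ((m : ℕ) : ℝ)) ^ σ) /
                  (1 - ((n : ℕ) : ℝ) / ((m : ℕ) : ℝ)) : ℝ) : ℂ) := by
  have hσ0 : 0 ≤ σ := hσ.1
  set A : ℕ+ → ℕ+ → ℂ := fun m n =>
        if m = n then 0
        else if m < n then
          -(Complex.I / ((n : ℕ) : ℂ)) *
            (((1 - (((m : ℕ) : ℝ) / ((n : ℕ) : ℝ)) ^ σ) /
                (1 - ((m : ℕ) : ℝ) / ((n : ℕ) : ℝ)) : ℝ) : ℂ)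
        else
          (Complex.I / ((m : ℕ) : ℂ)) *
            (((1 - (((n : ℕ) : ℝ) / ((m : ℕ) : ℝ)) ^ σ) /
                (1 - ((n : ℕ) : ℝ) / ((m : ℕ) : ℝ)) : ℝ) : ℂ) with hA
  have hdiag : ∀ m, A m m = 0 := fun m => by simp [hA]
  have hlt : ∀ m n : ℕ+, m < n → ‖A m n‖ ≤ 4 * σ / (fourthRoot m * fourthRoot n ^ 3) := by
    intro m n h
    have hle := difference_quotient_div_le hσ0 m.pos ((PNat.coe_lt_coe _ _).mpr h)
    rw [abs_mul, abs_of_nonneg (by positivity : (0 : ℝ) ≤ 1 / ((n : ℕ) : ℝ))] at hle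
    simpa only [hA, if_neg h.ne, if_pos h, norm_mul, norm_neg, norm_div Complex.I, Complex.norm_I,
      Complex.norm_natCast, Complex.norm_real, Real.norm_eq_abs] using hle
  have hgt : ∀ m n : ℕ+, n < m → ‖A m n‖ ≤ 4 * σ / (fourthRoot n * fourthRoot m ^ 3) := by
    intro m n h
    have hle := difference_quotient_div_le hσ0 n.pos ((PNat.coe_lt_coe _ _).mpr h)
    rw [abs_mul, abs_of_nonneg (by positivity : (0 : ℝ) ≤ 1 / ((m : ℕ) : ℝ))] at hle
    simpa only [hA, if_neg h.ne', if_neg h.not_gt, norm_mul, norm_div Complex.I, Complex.norm_I,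
      Complex.norm_natCast, Complex.norm_real, Real.norm_eq_abs] using hle
  obtain ⟨T, hT, hentries⟩ := exists_clm_of_schur_test A (fun n => 1 / fourthRoot n ^ 2)
    (fun n => one_div_pos.mpr (pow_pos (fourthRoot_pos n.pos) 2))
    (C := 32 * σ) (by positivity)
    (fun m S => sum_norm_mul_inv_fourthRoot_sq_le hσ0 (A m) m (hdiag m)
      (fun n h => hgt m n h) (fun n h => hlt m n h) S)
    (fun n S => sum_norm_mul_inv_fourthRoot_sq_le hσ0 (fun m => A m n) n (hdiag n)
      (fun m h => hlt m n h) (fun m h => hgt m n h) S)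
  refine ⟨T, hT.trans (mul_le_mul_of_nonneg_right ?_ hσ0), hentries⟩
  have hsqrt := Real.sqrt_nonneg 2
  calc (32 : ℝ) ≤ 4 * 3 ^ 2 := by norm_num
    _ ≤ (Real.sqrt 2 / 3 + 4) * Real.pi ^ 2 := by
        gcongr
        · linarith
        · exact Real.pi_gt_three.le
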